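/- arXiv:1812.06409 — 6 statements merged into one kernel-verified Lean document; each statement's English description precedes it below -/
import Mathlib

section
/- The σ-field B₀ on D generated by the closed balls of the uniform norm coincides with the projection σ-field P: B₀ = P. -/
/-- A function `x : ℝ → ℝ` is càdlàg on `[s,u]`. -/
def Cadlag (s u : ℝ) (x : ℝ → ℝ) : Prop :=
  (∀ t ∈ Set.Ico s u, Filter.Tendsto x (nhdsWithin t (Set.Ioc t u)) (nhds (x t))) ∧
  (∀ t ∈ Set.Ioc s u, ∃ L : ℝ, Filter.Tendsto x (nhdsWithin t (Set.Ico s t)) (nhds L))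

/-- The space `D` of càdlàg paths on `[s,u]` starting at `x₀`. -/
abbrev DSpace (s u x₀ : ℝ) : Type := {x : ℝ → ℝ // Cadlag s u x ∧ x s = x₀}

/-- The uniform distance on `D`. -/
noncomputable def unifDist (s u x₀ : ℝ) (x y : DSpace s u x₀) : ℝ :=
  sSup ((fun t => |x.1 t - y.1 t|) '' Set.Icc s u)

/-- The projection σ-field `P` on `D`. -/
def projSigma (s u x₀ : ℝ) : MeasurableSpace (DSpace s u x₀) :=
  ⨆ t ∈ Set.Icc s u, MeasurableSpace.comap (fun y : DSpace s u x₀ => y.1 t) inferInstance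

/-- The σ-field `B₀` on `D` generated by the closed balls of the uniform norm. -/
def ballSigma (s u x₀ : ℝ) : MeasurableSpace (DSpace s u x₀) :=
  MeasurableSpace.generateFrom
    {B : Set (DSpace s u x₀) | ∃ z ρ, 0 < ρ ∧ B = {y | unifDist s u x₀ z y ≤ ρ}}

open Set Filter Topology

theorem Cadlag.bdd {s u : ℝ} {x : ℝ → ℝ} (h : Cadlag s u x) :
    ∃ M, ∀ r ∈ Icc s u, |x r| ≤ M := by
  refine isCompact_Icc.induction_on (p := fun S => ∃ M, ∀ r ∈ S, |x r| ≤ M)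
    ⟨0, by simp⟩ (fun S T hST ⟨M, hM⟩ => ⟨M, fun r hr => hM r (hST hr)⟩) ?_ ?_
  · rintro S T ⟨M, hM⟩ ⟨N, hN⟩
    refine ⟨max M N, ?_⟩
    rintro r (hr | hr)
    · exact (hM r hr).trans (le_max_left _ _)
    · exact (hN r hr).trans (le_max_right _ _)
  · intro t ht
    have h1 : ∃ M, ∀ᶠ r in 𝓝[Ioc t u] t, |x r| ≤ M := by
      rcases ht.2.lt_or_eq with htu | rfl
      · exact ⟨|x t| + 1, ((h.1 t ⟨ht.1, htu⟩).abs).eventually_le_const (by linarith)⟩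
      · exact ⟨0, by simp⟩
    have h2 : ∃ M, ∀ᶠ r in 𝓝[Ico s t] t, |x r| ≤ M := by
      rcases ht.1.lt_or_eq with htu | rfl
      · obtain ⟨L, hL⟩ := h.2 t ⟨htu, ht.2⟩
        exact ⟨|L| + 1, hL.abs.eventually_le_const (by linarith)⟩
      · exact ⟨0, by simp⟩
    obtain ⟨M, hM⟩ := h1
    obtain ⟨N, hN⟩ := h2
    rw [eventually_nhdsWithin_iff] at hM hN
    refine ⟨{r | |x r| ≤ max (|x t|) (max M N)}, ?_, max (|x t|) (max M N), fun r hr => hr⟩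
    change ∀ᶠ r in 𝓝[Icc s u] t, |x r| ≤ max (|x t|) (max M N)
    rw [eventually_nhdsWithin_iff]
    filter_upwards [hM, hN] with r h1 h2 hr
    rcases lt_trichotomy r t with h | rfl | h
    · exact (h2 ⟨hr.1, h⟩).trans (by simp)
    · simp
    · exact (h1 ⟨h, hr.2⟩).trans (by simp)

theorem unifDist_le_iff {s u x₀ : ℝ} (hsu : s < u) (x y : DSpace s u x₀) (ρ : ℝ) :
    unifDist s u x₀ x y ≤ ρ ↔ ∀ t ∈ Icc s u, |x.1 t - y.1 t| ≤ ρ := by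
  obtain ⟨M, hM⟩ := x.2.1.bdd
  obtain ⟨N, hN⟩ := y.2.1.bdd
  unfold unifDist
  rw [csSup_le_iff]
  · exact forall_mem_image
  · refine ⟨M + N, ?_⟩
    rintro _ ⟨t, ht, rfl⟩
    exact (abs_sub _ _).trans (add_le_add (hM t ht) (hN t ht))
  · exact (nonempty_Icc.2 hsu.le).image _

theorem ball_countable {s u x₀ : ℝ} (x y : DSpace s u x₀) (ρ : ℝ) (hsu : s < u) :
    (∀ t ∈ Icc s u, |x.1 t - y.1 t| ≤ ρ) ↔
      (∀ q : ℚ, (q : ℝ) ∈ Icc s u → |x.1 q - y.1 q| ≤ ρ) ∧ |x.1 u - y.1 u| ≤ ρ := by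
  constructor
  · exact fun h => ⟨fun q hq => h q hq, h u ⟨hsu.le, le_rfl⟩⟩
  · rintro ⟨h1, h2⟩ t ht
    rcases ht.2.lt_or_eq with htu | rfl
    · by_contra! hc
      have := ((x.2.1.1 t ⟨ht.1, htu⟩).sub (y.2.1.1 t ⟨ht.1, htu⟩)).abs.eventually_const_lt hc
      rw [nhdsWithin_Ioc_eq_nhdsGT htu] at this
      obtain ⟨b, hb, hsub⟩ := (mem_nhdsGT_iff_exists_Ioo_subset).1 this
      obtain ⟨q, hq1, hq2⟩ := exists_rat_btwn (lt_min (show t < b from hb) htu)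
      have hq : ρ < |x.1 q - y.1 q| := hsub ⟨hq1, hq2.trans_le (min_le_left _ _)⟩
      exact absurd (h1 q ⟨ht.1.trans hq1.le, hq2.le.trans (min_le_right _ _)⟩) (not_le.2 hq)
    · exact h2

open Classical in
theorem cadlag_bump (s u x₀ t t' c : ℝ) (htt : t < t') :
    Cadlag s u (fun r => if r ∈ Ico t t' then c else x₀) := by
  constructor
  · intro r hr
    refine tendsto_const_nhds.congr' ?_
    rw [EventuallyEq, eventually_nhdsWithin_iff]
    rcases lt_or_ge r t with h | h
    · filter_upwards [Iio_mem_nhds h] with q hq hq2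
      simp only [mem_Ico, mem_Iio, mem_Ioc] at *
      rw [if_neg (by grind), if_neg (by grind)]
    rcases lt_or_ge r t' with h' | h'
    · filter_upwards [Iio_mem_nhds h'] with q hq hq2
      simp only [mem_Ico, mem_Iio, mem_Ioc] at *
      rw [if_pos (by grind), if_pos (by grind)]
    · filter_upwards with q hq2
      simp only [mem_Ico, mem_Ioc] at *
      rw [if_neg (by grind), if_neg (by grind)]
  · intro r hr
    have key : ∀ d : ℝ, (∀ᶠ q in 𝓝 r, q ∈ Ico s r → d = if q ∈ Ico t t' then c else x₀) →
        ∃ L, Tendsto (fun r => if r ∈ Ico t t' then c else x₀) (𝓝[Ico s r] r) (𝓝 L) := by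
      intro d hd
      refine ⟨d, tendsto_const_nhds.congr' ?_⟩
      rwa [EventuallyEq, eventually_nhdsWithin_iff]
    rcases le_or_gt r t with h | h
    · apply key x₀
      filter_upwards with q hq2
      simp only [mem_Ico] at *
      rw [if_neg (by grind)]
    rcases le_or_gt r t' with h' | h'
    · apply key c
      filter_upwards [Ioi_mem_nhds h] with q hq hq2
      simp only [mem_Ico, mem_Ioi] at *
      rw [if_pos (by grind)]
    · apply key x₀
      filter_upwards [Ioi_mem_nhds h'] with q hq hq2
      simp only [mem_Ico, mem_Ioi] at *
      rw [if_neg (by grind)]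

open Classical in
/-- The centre of the balls used to recover evaluation at `t`. -/
noncomputable def bump (s u x₀ t a : ℝ) (hst : s < t) (n : ℕ) : DSpace s u x₀ :=
  ⟨fun r => if r ∈ Ico t (t + 1 / ((n : ℝ) + 1)) then a + 1 / ((n : ℝ) + 1) + (n + 1) else x₀,
    cadlag_bump _ _ _ _ _ _ (by have : (0:ℝ) < 1 / ((n : ℝ) + 1) := by positivity
                                linarith),
    if_neg (fun h => absurd h.1 (not_le.2 hst))⟩

theorem eval_eq_union (s u x₀ t a : ℝ) (hsu : s < u) (hst : s < t) (htu : t ≤ u) :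
    {y : DSpace s u x₀ | a < y.1 t} =
      ⋃ n : ℕ, {y | unifDist s u x₀ (bump s u x₀ t a hst n) y ≤ (n : ℝ) + 1} := by
  ext y
  simp only [mem_setOf_eq, mem_iUnion, unifDist_le_iff hsu]
  constructor
  · intro hy
    obtain ⟨M, hM⟩ := y.2.1.bdd
    obtain ⟨b, hb, c, hc, hbc⟩ : ∃ b > t, ∃ c > a, ∀ r ∈ Ico t b, r ≤ u → c < y.1 r := by
      obtain ⟨c, hc1, hc2⟩ := exists_between hy
      rcases htu.lt_or_eq with h | rfl
      · have := (y.2.1.1 t ⟨hst.le, h⟩).eventually_const_lt hc2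
        rw [nhdsWithin_Ioc_eq_nhdsGT h] at this
        obtain ⟨b, hb, hsub⟩ := (mem_nhdsGT_iff_exists_Ioo_subset).1 this
        refine ⟨b, hb, c, hc1, fun r hr _ => ?_⟩
        rcases hr.1.lt_or_eq with h | rfl
        · exact hsub ⟨h, hr.2⟩
        · exact hc2
      · refine ⟨t + 1, by linarith, c, hc1, fun r hr h => ?_⟩
        rwa [le_antisymm h hr.1]
    obtain ⟨n1, hn1⟩ := exists_nat_one_div_lt (show 0 < min (b - t) (c - a) by
      apply lt_min <;> linarith)
    obtain ⟨n2, hn2⟩ := exists_nat_ge (M + |x₀| + |a|)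
    set n := max n1 n2
    have e1 : 1 / ((n : ℝ) + 1) ≤ 1 / ((n1 : ℝ) + 1) := by
      apply one_div_le_one_div_of_le (by positivity)
      have : (n1 : ℝ) ≤ n := by exact_mod_cast le_max_left _ _
      linarith
    have e2 : (n2 : ℝ) ≤ n := by exact_mod_cast le_max_right _ _
    have e3 : 0 < 1 / ((n : ℝ) + 1) := by positivity
    obtain ⟨e4, e5⟩ := lt_min_iff.1 hn1
    have e6 : (0:ℝ) ≤ n := by positivity
    refine ⟨n, fun r hr => ?_⟩
    have hMr := hM r hr
    have hx := abs_nonneg x₀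
    have ha := abs_nonneg a
    have ha' := neg_abs_le a
    simp only [bump]
    split_ifs with h
    · have := hbc r ⟨h.1, by linarith [h.2]⟩ hr.2
      have := (abs_le.1 hMr)
      rw [abs_le]
      constructor <;> linarith
    · exact (abs_sub _ _).trans (by linarith)
  · rintro ⟨n, hn⟩
    have := hn t ⟨hst.le, htu⟩
    have e3 : 0 < 1 / ((n : ℝ) + 1) := by positivity
    simp only [bump] at this
    rw [if_pos ⟨le_rfl, by linarith⟩, abs_le] at this
    linarith [this.2]

/-- The σ-field generated by the closed balls of the uniform norm coincides with the
projection σ-field: `B₀ = P`. -/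
theorem ballSigma_eq_projSigma (s u x₀ : ℝ) (hsu : s < u) :
    ballSigma s u x₀ = projSigma s u x₀ := by
  apply le_antisymm
  · apply MeasurableSpace.generateFrom_le
    rintro _ ⟨z, ρ, -, rfl⟩
    letI : MeasurableSpace (DSpace s u x₀) := projSigma s u x₀
    have hm : ∀ t ∈ Icc s u, Measurable (fun y : DSpace s u x₀ => y.1 t) := fun t ht =>
      Measurable.of_comap_le (le_iSup₂ (f := fun t (_ : t ∈ Icc s u) =>
        MeasurableSpace.comap (fun y : DSpace s u x₀ => y.1 t) inferInstance) t ht)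
    have hs : ∀ t ∈ Icc s u, MeasurableSet {y : DSpace s u x₀ | |z.1 t - y.1 t| ≤ ρ} := by
      intro t ht
      have h : Measurable (fun y : DSpace s u x₀ => |z.1 t - y.1 t|) := by
        have := (hm t ht).const_sub (z.1 t)
        exact continuous_abs.measurable.comp this
      exact h measurableSet_Iic
    have : {y | unifDist s u x₀ z y ≤ ρ} =
        (⋂ q : ℚ, ⋂ _ : (q : ℝ) ∈ Icc s u, {y : DSpace s u x₀ | |z.1 q - y.1 q| ≤ ρ}) ∩
          {y : DSpace s u x₀ | |z.1 u - y.1 u| ≤ ρ} := by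
      ext y
      simp only [mem_setOf_eq, mem_inter_iff, mem_iInter, unifDist_le_iff hsu,
        ball_countable _ _ _ hsu]
    rw [this]
    exact (MeasurableSet.iInter fun q : ℚ => MeasurableSet.iInter fun hq => hs (q : ℝ) hq).inter
      (hs u ⟨hsu.le, le_rfl⟩)
  · refine iSup₂_le fun t ht => ?_
    letI : MeasurableSpace (DSpace s u x₀) := ballSigma s u x₀
    apply Measurable.comap_le
    rcases ht.1.lt_or_eq with hst | rfl
    · refine measurable_of_Ioi fun a => ?_
      change MeasurableSet {y : DSpace s u x₀ | a < y.1 t}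
      rw [eval_eq_union s u x₀ t a hsu hst ht.2]
      exact MeasurableSet.iUnion fun n =>
        MeasurableSpace.measurableSet_generateFrom ⟨_, _, by positivity, rfl⟩
    · have : (fun y : DSpace s u x₀ => y.1 s) = fun _ => x₀ := funext fun y => y.2.2
      rw [this]
      exact measurable_const
end

section
/- Let s < u be real numbers, x₀, d ∈ ℝ, and let f : ℝ → ℝ be globally Lipschitz with Lipschitz constant L. Then there exist constants A > 0 and B ≥ 0, depending only on L, s, u, x₀, d and f(0), such that for every absolutely continuous function z : [s,u] → ℝ with z(s) = x₀ whose derivative ż is square integrable, ∫ₛᵘ (ż(t) − f(z(t)) + d)² dt ≥ A ∫ₛᵘ ż(t)² dt − B. -/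
open MeasureTheory Set in
theorem OM_aux (K C s u x₀ d : ℝ) (hsu : s < u) (hK : 0 < K) (hC : 0 ≤ C)
    (f z v : ℝ → ℝ) (hfc : Continuous f)
    (hf : ∀ x, |f x| + |d| ≤ C + K * |x - x₀|)
    (hv : IntervalIntegrable v volume s u)
    (hv2 : IntervalIntegrable (fun t => (v t) ^ 2) volume s u)
    (hz : ∀ t ∈ Icc s u, z t = x₀ + ∫ r in s..t, v r) :
    (∫ t in s..u, (v t) ^ 2) ≤
      (2 + 8 * K ^ 2 * (Real.exp (K * (u - s))) ^ 2 * (u - s) ^ 2) *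
        (∫ t in s..u, (v t - f (z t) + d) ^ 2)
      + (8 * K ^ 2 * (Real.exp (K * (u - s))) ^ 2 * C ^ 2 * (u - s) ^ 3
        + 4 * C ^ 2 * (u - s)) := by
  have hu : uIcc s u = Icc s u := uIcc_of_le hsu.le
  have hT : 0 < u - s := sub_pos.2 hsu
  have hsub : ∀ t ∈ Icc s u, uIcc s t ⊆ uIcc s u := by
    intro t ht
    rw [hu, uIcc_of_le ht.1]; exact Icc_subset_Icc_right ht.2
  have hva := hv.abs
  have hzc : ContinuousOn z (uIcc s u) := by
    have h1 : ContinuousOn (fun t => x₀ + ∫ r in s..t, v r) (uIcc s u) :=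
      continuousOn_const.add
        (intervalIntegral.continuousOn_primitive_interval'  hv left_mem_uIcc)
    exact h1.congr (fun t ht => hz t (hu ▸ ht))
  have hcc : ContinuousOn (fun t => - f (z t) + d) (uIcc s u) :=
    ((hfc.comp_continuousOn hzc).neg).add continuousOn_const
  have hw : IntervalIntegrable (fun t => v t - f (z t) + d) volume s u := by
    have := hv.add hcc.intervalIntegrable
    refine this.congr (fun t _ => ?_)
    ring
  have hw2 : IntervalIntegrable (fun t => (v t - f (z t) + d) ^ 2) volume s u := by
    have := (hv2.add ((hv.mul_continuousOn hcc).const_mul 2)).add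
      (hcc.pow 2).intervalIntegrable
    refine this.congr (fun t _ => ?_)
    simp only [Pi.pow_apply]; ring
  set w : ℝ → ℝ := fun t => v t - f (z t) + d with hwdef
  have hwa := hw.abs
  set g : ℝ → ℝ := fun t => ∫ r in s..t, |v r| with hg
  have hgc : ContinuousOn g (uIcc s u) :=
    intervalIntegral.continuousOn_primitive_interval' hva left_mem_uIcc
  have hg0 : ∀ t ∈ Icc s u, 0 ≤ g t := fun t ht =>
    intervalIntegral.integral_nonneg ht.1 (fun _ _ => abs_nonneg _)
  have hzg : ∀ t ∈ Icc s u, |z t - x₀| ≤ g t := by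
    intro t ht
    rw [hz t ht, add_sub_cancel_left]
    exact intervalIntegral.abs_integral_le_integral_abs ht.1
  have hvb : ∀ t ∈ Icc s u, |v t| ≤ |w t| + C + K * g t := by
    intro t ht
    have h1 := hf (z t)
    have h2 := mul_le_mul_of_nonneg_left (hzg t ht) hK.le
    have h3 : |v t| ≤ |w t| + |f (z t)| + |d| := by
      have : v t = w t + f (z t) - d := by simp only [hwdef]; ring
      rw [this]
      exact (abs_sub _ _).trans (add_le_add_left (abs_add_le _ _) _)
    linarith
  set I := ∫ t in s..u, |w t| with hI
  set W := ∫ t in s..u, (w t) ^ 2 with hW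
  have hI0 : 0 ≤ I := intervalIntegral.integral_nonneg hsu.le (fun _ _ => abs_nonneg _)
  have hCS : I ^ 2 ≤ (u - s) * W := by
    have h : 0 ≤ ∫ t in s..u, ((w t) ^ 2 - (2 * (I / (u - s))) * |w t| + (I / (u - s)) ^ 2) := by
      refine intervalIntegral.integral_nonneg hsu.le (fun t _ => ?_)
      have := sq_nonneg (|w t| - I / (u - s))
      have h2 := sq_abs (w t)
      nlinarith
    rw [intervalIntegral.integral_add (hw2.sub (hwa.const_mul _)) intervalIntegrable_const,
      intervalIntegral.integral_sub hw2 (hwa.const_mul _),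
      intervalIntegral.integral_const_mul, intervalIntegral.integral_const, smul_eq_mul] at h
    have h' := mul_nonneg hT.le h
    have e : (u - s) * (W - 2 * (I / (u - s)) * I + (u - s) * (I / (u - s)) ^ 2)
        = (u - s) * W - I ^ 2 := by field_simp; ring
    rw [e] at h'
    linarith
  set P := I + C * (u - s) with hP
  have hP0 : 0 ≤ P := by positivity
  set G : ℝ → ℝ := fun t => ∫ r in s..t, g r with hG
  have hgi : IntervalIntegrable g volume s u := hgc.intervalIntegrable
  have hG0 : ∀ t ∈ Icc s u, 0 ≤ G t := fun t ht =>
    intervalIntegral.integral_nonneg ht.1 (fun r hr => hg0 r ⟨hr.1, hr.2.trans ht.2⟩)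
  have hgG : ∀ t ∈ Icc s u, g t ≤ P + K * G t := by
    intro t ht
    have i1 := hwa.mono_set (hsub t ht)
    have i2 := hgi.mono_set (hsub t ht)
    have h1 : g t ≤ ∫ r in s..t, (|w r| + C + K * g r) := by
      refine intervalIntegral.integral_mono_on ht.1 (hva.mono_set (hsub t ht))
        ((i1.add intervalIntegrable_const).add (i2.const_mul K)) ?_
      exact fun r hr => hvb r ⟨hr.1, hr.2.trans ht.2⟩
    rw [intervalIntegral.integral_add (i1.add intervalIntegrable_const) (i2.const_mul K),
      intervalIntegral.integral_add i1 intervalIntegrable_const,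
      intervalIntegral.integral_const_mul, intervalIntegral.integral_const, smul_eq_mul] at h1
    have h2 : ∫ r in s..t, |w r| ≤ I :=
      intervalIntegral.integral_mono_interval le_rfl ht.1 ht.2
        (Filter.Eventually.of_forall fun _ => abs_nonneg _) hwa
    have h3 : (t - s) * C ≤ (u - s) * C :=
      mul_le_mul_of_nonneg_right (by linarith [ht.2]) hC
    have : K * G t = K * ∫ r in s..t, g r := rfl
    linarith
  have hGb : ∀ t ∈ Icc s u, ‖G t‖ ≤ gronwallBound 0 K P (t - s) := by
    refine norm_le_gronwallBound_of_norm_deriv_right_le (f' := g) ?_ ?_ ?_ ?_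
    · rw [← hu]
      exact intervalIntegral.continuousOn_primitive_interval' hgi left_mem_uIcc
    · intro t ht
      have htI : t ∈ Icc s u := ⟨ht.1, ht.2.le⟩
      have hnb : Icc s u ∈ nhdsWithin t (Ioi t) := by
        exact Filter.mem_of_superset (Ioo_mem_nhdsGT ht.2)
          (fun x hx => ⟨ht.1.trans hx.1.le, hx.2.le⟩)
      have hct : ContinuousWithinAt g (Ici t) t := by
        have := (hgc t (hu ▸ htI)).mono (s := Icc t u) (by
          rw [hu]; exact Icc_subset_Icc_left ht.1)
        exact this.mono_of_mem_nhdsWithin (Icc_mem_nhdsGE ht.2)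
      refine intervalIntegral.integral_hasDerivWithinAt_right
        (hgi.mono_set (hsub t htI)) ?_ (t := Ioi t) (hct.mono Ioi_subset_Ici_self)
      exact ⟨Icc s u, hnb, (hu ▸ hgc).aestronglyMeasurable measurableSet_Icc⟩
    · simp [hG]
    · intro t ht
      have htI : t ∈ Icc s u := ⟨ht.1, ht.2.le⟩
      rw [Real.norm_of_nonneg (hg0 t htI), Real.norm_of_nonneg (hG0 t htI)]
      linarith [hgG t htI]
  set M := Real.exp (K * (u - s)) with hM
  have hM0 : 0 < M := Real.exp_pos _
  have hgM : ∀ t ∈ Icc s u, g t ≤ P * M := by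
    intro t ht
    have h1 := hGb t ht
    rw [Real.norm_of_nonneg (hG0 t ht), gronwallBound_of_K_ne_0 hK.ne'] at h1
    have h2 : Real.exp (K * (t - s)) ≤ M := Real.exp_le_exp.2
      (mul_le_mul_of_nonneg_left (by linarith [ht.2]) hK.le)
    have h3 := mul_le_mul_of_nonneg_left h1 hK.le
    have e : K * (0 * Real.exp (K * (t - s)) + P / K * (Real.exp (K * (t - s)) - 1))
      = P * Real.exp (K * (t - s)) - P := by field_simp; ring
    have h4 := mul_le_mul_of_nonneg_left h2 hP0
    linarith [hgG t ht]
  have hfin : (∫ t in s..u, (v t) ^ 2) ≤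
      ∫ t in s..u, (2 * (w t) ^ 2 + (4 * (K * (P * M)) ^ 2 + 4 * C ^ 2)) := by
    refine intervalIntegral.integral_mono_on hsu.le hv2
      ((hw2.const_mul 2).add intervalIntegrable_const) ?_
    intro t ht
    have h1 : |v t| ≤ |w t| + C + K * (P * M) := by
      have := mul_le_mul_of_nonneg_left (hgM t ht) hK.le
      linarith [hvb t ht]
    have h2 := pow_le_pow_left₀ (abs_nonneg _) h1 2
    rw [sq_abs] at h2
    nlinarith [sq_abs (w t), sq_nonneg (|w t| - (C + K * (P * M))),
      sq_nonneg (C - K * (P * M))]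
  rw [intervalIntegral.integral_add (hw2.const_mul 2) intervalIntegrable_const,
      intervalIntegral.integral_const_mul, intervalIntegral.integral_const, smul_eq_mul] at hfin
  have hP2 : P ^ 2 ≤ 2 * ((u - s) * W) + 2 * (C * (u - s)) ^ 2 := by
    nlinarith [sq_nonneg (I - C * (u - s))]
  have h5 := mul_le_mul_of_nonneg_left hP2 (show 0 ≤ (u - s) * (4 * K ^ 2 * M ^ 2) by positivity)
  refine hfin.trans ?_
  change 2 * W + _ ≤ _
  linarith

/-- Coercivity estimate: if `f` is globally Lipschitz with constant `L`, there are
constants `A > 0` and `B ≥ 0`, depending only on `L, s, u, x₀, d` and `f 0 = y₀`, such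
that for every absolutely continuous `z : [s,u] → ℝ` with `z s = x₀` and square
integrable derivative `ż = v`,
`∫ₛᵘ (ż − f(z) + d)² dt ≥ A ∫ₛᵘ ż² dt − B`. -/
theorem OM_coercivity (L s u x₀ d y₀ : ℝ) (hsu : s < u) :
    ∃ A B : ℝ, 0 < A ∧ 0 ≤ B ∧
      ∀ f : ℝ → ℝ, f 0 = y₀ → (∀ x y : ℝ, |f x - f y| ≤ L * |x - y|) →
        ∀ z v : ℝ → ℝ,
          MeasureTheory.IntegrableOn v (Set.Icc s u) MeasureTheory.volume →
          MeasureTheory.IntegrableOn (fun t => (v t) ^ 2) (Set.Icc s u)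
            MeasureTheory.volume →
          (∀ t ∈ Set.Icc s u, z t = x₀ + ∫ r in s..t, v r) →
          A * (∫ t in s..u, (v t) ^ 2) - B ≤ ∫ t in s..u, (v t - f (z t) + d) ^ 2 := by

  set K := |L| + 1 with hK
  set C := |y₀| + |L| * |x₀| + |d| with hC
  have hK0 : 0 < K := by positivity
  have hC0 : 0 ≤ C := by positivity
  have hT : 0 < u - s := sub_pos.2 hsu
  set Q := 2 + 8 * K ^ 2 * (Real.exp (K * (u - s))) ^ 2 * (u - s) ^ 2 with hQ
  set R := 8 * K ^ 2 * (Real.exp (K * (u - s))) ^ 2 * C ^ 2 * (u - s) ^ 3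
        + 4 * C ^ 2 * (u - s) with hR
  have hQ0 : 0 < Q := by positivity
  have hR0 : 0 ≤ R := by positivity
  refine ⟨Q⁻¹, Q⁻¹ * R, by positivity, by positivity, ?_⟩
  intro f hf0 hf z v hv hv2 hz
  have hL : ∀ x y, |f x - f y| ≤ |L| * |x - y| := fun x y =>
    (hf x y).trans (mul_le_mul_of_nonneg_right (le_abs_self L) (abs_nonneg _))
  have hfc : Continuous f := by
    have : LipschitzWith (Real.toNNReal |L|) f := by
      refine LipschitzWith.of_dist_le_mul (fun x y => ?_)
      rw [Real.dist_eq, Real.dist_eq, Real.coe_toNNReal _ (abs_nonneg L)]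
      exact hL x y
    exact this.continuous
  have hfb : ∀ x, |f x| + |d| ≤ C + K * |x - x₀| := by
    intro x
    have h1 := hL x 0
    rw [hf0, sub_zero] at h1
    have h2 : |f x| ≤ |f x - y₀| + |y₀| := by
      simpa using abs_add_le (f x - y₀) y₀
    have h3 : |x| ≤ |x - x₀| + |x₀| := by
      simpa using abs_add_le (x - x₀) x₀
    have h4 := mul_le_mul_of_nonneg_left h3 (abs_nonneg L)
    have h5 := abs_nonneg (x - x₀)
    have h6 : K * |x - x₀| = |L| * |x - x₀| + |x - x₀| := by rw [hK]; ring
    linarith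
  have key := OM_aux K C s u x₀ d hsu hK0 hC0 f z v hfc hfb
    ((intervalIntegrable_iff_integrableOn_Icc_of_le hsu.le).2 hv)
    ((intervalIntegrable_iff_integrableOn_Icc_of_le hsu.le).2 hv2) hz
  rw [← mul_sub, inv_mul_le_iff₀ hQ0]
  linarith
end

section
/- Let s < u, c ≠ 0, d ∈ ℝ, and let f : ℝ → ℝ be continuously differentiable, globally Lipschitz, with f′(x) ≥ M for all x ∈ ℝ for some constant M, and assume d² ≥ M c². Let A be the set of absolutely continuous functions z : [s,u] → ℝ with square-integrable derivative satisfying z(s) = x₀ and z(u) = x₁. Then there exists z* ∈ A such that I[z*] = min_{z ∈ A} I[z], where I[z] = ∫ₛᵘ OM(ż(t), z(t)) dt is the Onsager–Machlup functional. -/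
/-- The Onsager–Machlup function of the jump-diffusion
`dX = f(X)dt + c dB + ∫_{|x|<1} x Ñ(dt,dx)`, with small-jump mean `d`:
`OM(p, y) = ((p − f(y))/c)² + f′(y) + 2((p − f(y))/c²) d`. -/
noncomputable def OMfn (f : ℝ → ℝ) (c d p y : ℝ) : ℝ :=
  ((p - f y) / c) ^ 2 + deriv f y + 2 * ((p - f y) / c ^ 2) * d

/-- An admissible pair `(z, v)`: `z` is absolutely continuous on `[s,u]` with square
integrable derivative `ż = v`, `z s = x₀` and `z u = x₁`. -/
def AdmissiblePair (s u x₀ x₁ : ℝ) (z v : ℝ → ℝ) : Prop :=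
  MeasureTheory.IntegrableOn v (Set.Icc s u) MeasureTheory.volume ∧
  MeasureTheory.IntegrableOn (fun t => (v t) ^ 2) (Set.Icc s u) MeasureTheory.volume ∧
  (∀ t ∈ Set.Icc s u, z t = x₀ + ∫ r in s..t, v r) ∧ z u = x₁

/-- The Onsager–Machlup functional `I[z] = ∫ₛᵘ OM(ż(t), z(t)) dt` with `ż = v`. -/
noncomputable def OMfunctional (s u c d : ℝ) (f z v : ℝ → ℝ) : ℝ :=
  ∫ t in s..u, OMfn f c d (v t) (z t)

open MeasureTheory Filter Topology Set in
/-- Abstract direct method in a separable Hilbert space. -/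
theorem om_abstract {H : Type*} [NormedAddCommGroup H] [InnerProductSpace ℝ H] [CompleteSpace H]
    [TopologicalSpace.SeparableSpace H] (μ : Measure ℝ) [IsFiniteMeasure μ]
    (e : ℝ → H) (R : ℝ) (hR : ∀ t, ‖e t‖ ≤ R) (e1 : H) (x₀ x₁ a m : ℝ) (ha : 0 < a)
    (h : ℝ → ℝ) (hh : Continuous h) (hm : ∀ x, m ≤ h x)
    (hmeas : ∀ w : H, AEStronglyMeasurable (fun t => h (x₀ + inner ℝ (e t) w)) μ)
    (hne : ∃ w : H, x₀ + inner ℝ e1 w = x₁) :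
    ∃ w : H, x₀ + inner ℝ e1 w = x₁ ∧ ∀ w' : H, x₀ + inner ℝ e1 w' = x₁ →
      a * ‖w‖ ^ 2 + ∫ t, h (x₀ + inner ℝ (e t) w) ∂μ ≤
      a * ‖w'‖ ^ 2 + ∫ t, h (x₀ + inner ℝ (e t) w') ∂μ := by
  have hR0 : 0 ≤ R := (norm_nonneg _).trans (hR 0)
  have hin : ∀ (t : ℝ) (w : H) (r : ℝ), ‖w‖ ≤ r → x₀ + inner ℝ (e t) w ∈
      Icc (-(|x₀| + R * r)) (|x₀| + R * r) := by
    intro t w r hr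
    rw [mem_Icc, ← abs_le]
    refine (abs_add_le _ _).trans ?_
    gcongr
    refine (abs_real_inner_le_norm _ _).trans ?_
    gcongr
    exact hR t
  have hbd : ∀ r : ℝ, ∃ C, ∀ (t : ℝ) (w : H), ‖w‖ ≤ r → ‖h (x₀ + inner ℝ (e t) w)‖ ≤ C := by
    intro r
    obtain ⟨C, hC⟩ := (isCompact_Icc (a := (-(|x₀| + R * r)))
      (b := |x₀| + R * r)).exists_bound_of_continuousOn hh.continuousOn
    exact ⟨C, fun t w hw => hC _ (hin t w r hw)⟩
  have hint : ∀ w : H, Integrable (fun t => h (x₀ + inner ℝ (e t) w)) μ := by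
    intro w
    obtain ⟨C, hC⟩ := hbd ‖w‖
    exact Integrable.of_bound (hmeas w) C (Eventually.of_forall fun t => hC t w le_rfl)
  have hlow : ∀ w : H, μ.real univ * m ≤ ∫ t, h (x₀ + inner ℝ (e t) w) ∂μ := by
    intro w
    have := integral_mono (integrable_const m) (hint w) (fun t => hm _)
    simpa using this
  set J : H → ℝ := fun w => a * ‖w‖ ^ 2 + ∫ t, h (x₀ + inner ℝ (e t) w) ∂μ with hJ
  set S : Set H := {w | x₀ + inner ℝ e1 w = x₁} with hS
  have hSne : (J '' S).Nonempty := by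
    obtain ⟨w, hw⟩ := hne
    exact ⟨J w, w, hw, rfl⟩
  have hSb : BddBelow (J '' S) := by
    refine ⟨μ.real univ * m, ?_⟩
    rintro _ ⟨w, -, rfl⟩
    have := hlow w
    have : 0 ≤ a * ‖w‖ ^ 2 := by positivity
    simp only [hJ]; linarith
  obtain ⟨y, -, hy, hyS⟩ := exists_seq_tendsto_sInf hSne hSb
  choose w hwS hwy using hyS
  have hJw : Tendsto (fun n => J (w n)) atTop (𝓝 (sInf (J '' S))) := by
    simpa only [hwy] using hy
  obtain ⟨B, hB⟩ := hJw.bddAbove_range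
  have hB' : ∀ n, J (w n) ≤ B := fun n => hB ⟨n, rfl⟩
  set r := Real.sqrt ((B - μ.real univ * m) / a) with hr
  have hwr : ∀ n, ‖w n‖ ≤ r := by
    intro n
    apply Real.le_sqrt_of_sq_le
    rw [le_div_iff₀ ha]
    have h1 := hB' n
    have h2 := hlow (w n)
    simp only [hJ] at h1
    linarith
  obtain ⟨ℓ, -, φ, hφ, hlim⟩ := WeakDual.isSeqCompact_closedBall ℝ H 0 r
    (x := fun n => StrongDual.toWeakDual (InnerProductSpace.toDual ℝ H (w n))) (by
      intro n
      simp only [mem_preimage, mem_closedBall_zero_iff]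
      have : ‖InnerProductSpace.toDual ℝ H (w n)‖ ≤ r := by
        rw [LinearIsometryEquiv.norm_map]; exact hwr n
      exact this)
  set W : H := (InnerProductSpace.toDual ℝ H).symm (WeakDual.toStrongDual ℓ) with hW
  have hweak : ∀ y : H, Tendsto (fun n => inner ℝ y (w (φ n))) atTop (𝓝 (inner ℝ y W)) := by
    intro y
    have h1 := ((WeakDual.eval_continuous (𝕜 := ℝ) y).tendsto ℓ).comp hlim
    have h2 : inner ℝ y W = ℓ y := by
      rw [real_inner_comm, hW, InnerProductSpace.toDual_symm_apply]; rfl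
    rw [h2]
    refine h1.congr fun n => ?_
    rw [real_inner_comm]
    simp
  refine ⟨W, ?_, ?_⟩
  · have h1 := (hweak e1).const_add x₀
    have h2 : ∀ n, x₀ + inner ℝ e1 (w (φ n)) = x₁ := fun n => hwS (φ n)
    simp only [h2] at h1
    exact tendsto_nhds_unique h1 tendsto_const_nhds |>.symm ▸ rfl
  · intro w' hw'
    obtain ⟨C, hC⟩ := hbd r
    have hdct : Tendsto (fun n => ∫ t, h (x₀ + inner ℝ (e t) (w (φ n))) ∂μ) atTop
        (𝓝 (∫ t, h (x₀ + inner ℝ (e t) W) ∂μ)) := by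
      refine tendsto_integral_of_dominated_convergence (fun _ => C) (fun n => hmeas _)
        (integrable_const C) (fun n => Eventually.of_forall fun t => hC t _ (hwr _)) ?_
      refine Eventually.of_forall fun t => ?_
      exact (hh.tendsto _).comp ((hweak (e t)).const_add x₀)
    have h1 : Tendsto (fun n => a * (2 * inner ℝ W (w (φ n)) - ‖W‖ ^ 2) +
        ∫ t, h (x₀ + inner ℝ (e t) (w (φ n))) ∂μ) atTop
        (𝓝 (a * (2 * inner ℝ W W - ‖W‖ ^ 2) + ∫ t, h (x₀ + inner ℝ (e t) W) ∂μ)) :=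
      ((((hweak W).const_mul 2).sub_const _).const_mul a).add hdct
    have h2 := le_of_tendsto_of_tendsto' h1 (hJw.comp hφ.tendsto_atTop) (fun n => by
      simp only [Function.comp, hJ]
      gcongr
      have := norm_sub_sq_real W (w (φ n))
      nlinarith [sq_nonneg ‖W - w (φ n)‖])
    have h3 : sInf (J '' S) ≤ J w' := csInf_le hSb ⟨w', hw', rfl⟩
    rw [real_inner_self_eq_norm_sq] at h2
    have h4 : a * (2 * ‖W‖ ^ 2 - ‖W‖ ^ 2) = a * ‖W‖ ^ 2 := by ring
    rw [h4] at h2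
    exact h2.trans h3

open MeasureTheory Filter Topology Set in
/-- Lipschitz functions preserve absolute continuity. -/
theorem om_ac_comp {G z : ℝ → ℝ} {a b : ℝ} (hG : ContDiff ℝ 1 G)
    (hz : AbsolutelyContinuousOnInterval z a b) :
    AbsolutelyContinuousOnInterval (fun t => G (z t)) a b := by
  obtain ⟨C, hC⟩ := hz.exists_bound
  obtain ⟨K, hK⟩ := (hG.contDiffOn (s := Icc (-C) C)).exists_lipschitzOnWith (by decide)
    (convex_Icc _ _) isCompact_Icc
  have hmem : ∀ t ∈ uIcc a b, z t ∈ Icc (-C) C := fun t ht => abs_le.mp (hC t ht)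
  rw [absolutelyContinuousOnInterval_iff] at hz ⊢
  intro ε hε
  obtain ⟨δ, hδ, H⟩ := hz (ε / (K + 1)) (by positivity)
  refine ⟨δ, hδ, fun E hE hEδ => ?_⟩
  have h1 := H E hE hEδ
  calc _ ≤ ∑ i ∈ Finset.range E.1, (K : ℝ) * dist (z (E.2 i).1) (z (E.2 i).2) := by
        apply Finset.sum_le_sum
        intro i hi
        exact hK.dist_le_mul _ (hmem _ (hE.1 i hi).1) _ (hmem _ (hE.1 i hi).2)
    _ = K * ∑ i ∈ Finset.range E.1, dist (z (E.2 i).1) (z (E.2 i).2) := by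
        rw [Finset.mul_sum]
    _ ≤ K * (ε / (K + 1)) := by gcongr
    _ < (K + 1) * (ε / (K + 1)) := by gcongr; linarith
    _ = ε := by field

open MeasureTheory Filter Topology Set in
/-- Chain rule for absolutely continuous paths. -/
theorem om_chain {g v : ℝ → ℝ} {s u x₀ : ℝ} (hg : Continuous g)
    (hv : IntervalIntegrable v volume s u) :
    ∫ t in s..u, g (x₀ + ∫ r in s..t, v r) * v t =
      (∫ y in (0:ℝ)..(x₀ + ∫ r in s..u, v r), g y) - ∫ y in (0:ℝ)..x₀, g y := by
  set G : ℝ → ℝ := fun x => ∫ y in (0:ℝ)..x, g y with hGdef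
  have hGd : ∀ x, HasDerivAt G (g x) x := fun x => hg.integral_hasStrictDerivAt 0 x |>.hasDerivAt
  have hG : ContDiff ℝ 1 G := by
    rw [contDiff_one_iff_deriv]
    refine ⟨fun x => (hGd x).differentiableAt, ?_⟩
    have : deriv G = g := funext fun x => (hGd x).deriv
    rwa [this]
  have hac0 := hv.absolutelyContinuousOnInterval_intervalIntegral (c := s) left_mem_uIcc
  have hac : AbsolutelyContinuousOnInterval (fun t => G (x₀ + ∫ r in s..t, v r)) s u :=
    om_ac_comp (G := fun y => G (x₀ + y)) (hG.comp (contDiff_const.add contDiff_id)) hac0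
  have h1 := hac.integral_deriv_eq_sub
  simp only [intervalIntegral.integral_same, add_zero] at h1
  rw [← h1]
  apply intervalIntegral.integral_congr_ae
  filter_upwards [hv.ae_hasDerivAt_integral] with t ht htm
  have h2 := ht (uIoc_subset_uIcc htm) s left_mem_uIcc
  exact (((hGd _).comp t (h2.const_add x₀)).deriv).symm

open MeasureTheory Filter Topology Set in
/-- Rewriting of the functional: the cross term is a boundary term. -/
theorem om_rewrite (s u c d x₀ x₁ : ℝ)
    (hsu : s < u) (f : ℝ → ℝ) (hf : ContDiff ℝ 1 f) (z v : ℝ → ℝ)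
    (hzv : AdmissiblePair s u x₀ x₁ z v) :
    OMfunctional s u c d f z v =
      ((1 / c ^ 2) * (∫ t in Ioc s u, v t ^ 2) +
      ∫ t in Ioc s u, (fun y => 1 / c ^ 2 * (f y - d) ^ 2 + deriv f y - 1 / c ^ 2 * d ^ 2)
        (x₀ + ∫ r in s..t, v r)) -
      2 * (1 / c ^ 2) * ((∫ y in (0:ℝ)..x₁, (f y - d)) - ∫ y in (0:ℝ)..x₀, (f y - d)) := by
  obtain ⟨hv, hv2, hz, hzu⟩ := hzv
  have hvi : IntervalIntegrable v volume s u :=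
    (intervalIntegrable_iff_integrableOn_Icc_of_le hsu.le).mpr hv
  have hv2i : IntervalIntegrable (fun t => v t ^ 2) volume s u :=
    (intervalIntegrable_iff_integrableOn_Icc_of_le hsu.le).mpr hv2
  have hx1 : x₀ + ∫ r in s..u, v r = x₁ := by rw [← hzu, hz u (right_mem_Icc.mpr hsu.le)]
  have hgc : Continuous (fun y => f y - d) := hf.continuous.sub continuous_const
  have hfd : Continuous (deriv f) := hf.continuous_deriv le_rfl
  have hcz : ContinuousOn (fun t => x₀ + ∫ r in s..t, v r) (uIcc s u) :=
    continuousOn_const.add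
      (hvi.absolutelyContinuousOnInterval_intervalIntegral (c := s) left_mem_uIcc).continuousOn
  set h : ℝ → ℝ := fun y => 1 / c ^ 2 * (f y - d) ^ 2 + deriv f y - 1 / c ^ 2 * d ^ 2 with hh
  have hhc : Continuous h := by
    have := hf.continuous
    fun_prop
  have hi1 : IntervalIntegrable (fun t => h (x₀ + ∫ r in s..t, v r)) volume s u :=
    (hhc.comp_continuousOn hcz).intervalIntegrable
  have hi2 : IntervalIntegrable (fun t => (fun y => f y - d) (x₀ + ∫ r in s..t, v r) * v t)
      volume s u :=
    hvi.continuousOn_mul (hgc.comp_continuousOn hcz)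
  have hch := om_chain (x₀ := x₀) hgc hvi
  rw [hx1] at hch
  rw [← hch, ← intervalIntegral.integral_of_le hsu.le, ← intervalIntegral.integral_of_le hsu.le,
    ← intervalIntegral.integral_const_mul, ← intervalIntegral.integral_const_mul,
    ← intervalIntegral.integral_add (hv2i.const_mul _) hi1,
    ← intervalIntegral.integral_sub ((hv2i.const_mul _).add hi1) (hi2.const_mul _)]
  unfold OMfunctional
  apply intervalIntegral.integral_congr
  intro t ht
  rw [uIcc_of_le hsu.le] at ht
  simp only [OMfn, hh, hz t ht]
  ring

open MeasureTheory Filter Topology Set in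
/-- The Hilbert space form of the problem. -/
theorem om_exists (s u c d x₀ x₁ M : ℝ)
    (hsu : s < u) (hc : c ≠ 0) (f : ℝ → ℝ) (hf : ContDiff ℝ 1 f)
    (hlb : ∀ x : ℝ, M ≤ deriv f x) :
    ∃ zs vs : ℝ → ℝ, AdmissiblePair s u x₀ x₁ zs vs ∧
      ∀ z v : ℝ → ℝ, AdmissiblePair s u x₀ x₁ z v →
        OMfunctional s u c d f zs vs ≤ OMfunctional s u c d f z v := by
  set μ : Measure ℝ := volume.restrict (Ioc s u) with hμ
  set h : ℝ → ℝ := fun y => 1 / c ^ 2 * (f y - d) ^ 2 + deriv f y - 1 / c ^ 2 * d ^ 2 with hh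
  have hfd : Continuous (deriv f) := hf.continuous_deriv le_rfl
  have hhc : Continuous h := by
    have := hf.continuous
    fun_prop
  have ha : 0 < 1 / c ^ 2 := by positivity
  have hm : ∀ x, M - 1 / c ^ 2 * d ^ 2 ≤ h x := by
    intro x
    have := hlb x
    have : 0 ≤ 1 / c ^ 2 * (f x - d) ^ 2 := by positivity
    simp only [hh]; linarith
  let e : ℝ → Lp ℝ 2 μ := fun t =>
    indicatorConstLp 2 (measurableSet_Ioc (a := s) (b := t)) (measure_ne_top μ _) (1 : ℝ)
  have he : ∀ t ∈ Icc s u, ∀ w : Lp ℝ 2 μ, inner ℝ (e t) w = ∫ r in s..t, w r := by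
    intro t ht w
    rw [L2.inner_indicatorConstLp_one, intervalIntegral.integral_of_le ht.1,
      Measure.restrict_restrict measurableSet_Ioc,
      inter_eq_left.mpr (Ioc_subset_Ioc_right ht.2)]
  have heR : ∀ t, ‖e t‖ ≤ ‖e u‖ := by
    intro t
    simp only [e]
    rw [norm_indicatorConstLp (by simp) (by simp), norm_indicatorConstLp (by simp) (by simp)]
    have hle : μ.real (Ioc s t) ≤ μ.real (Ioc s u) := by
      rw [hμ, measureReal_restrict_apply measurableSet_Ioc,
        measureReal_restrict_apply measurableSet_Ioc, inter_self]
      exact measureReal_mono inter_subset_right measure_Ioc_lt_top.ne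
    gcongr
  have hwI : ∀ w : Lp ℝ 2 μ, IntegrableOn w (Icc s u) volume ∧
      IntegrableOn (fun t => w t ^ 2) (Icc s u) volume := by
    intro w
    rw [integrableOn_Icc_iff_integrableOn_Ioc enorm_ne_top,
      integrableOn_Icc_iff_integrableOn_Ioc enorm_ne_top]
    exact ⟨(Lp.memLp w).integrable (by norm_num), (Lp.memLp w).integrable_sq⟩
  have hnorm : ∀ w : Lp ℝ 2 μ, ‖w‖ ^ 2 = ∫ t in Ioc s u, w t ^ 2 := by
    intro w
    rw [← real_inner_self_eq_norm_sq, L2.inner_def]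
    simp [pow_two, hμ]
  have hadm : ∀ w : Lp ℝ 2 μ, x₀ + inner ℝ (e u) w = x₁ →
      AdmissiblePair s u x₀ x₁ (fun t => x₀ + ∫ r in s..t, w r) w := by
    intro w hw
    refine ⟨(hwI w).1, (hwI w).2, fun t _ => rfl, ?_⟩
    rw [← hw, he u (right_mem_Icc.mpr hsu.le)]
  have hJ : ∀ w : Lp ℝ 2 μ, 1 / c ^ 2 * ‖w‖ ^ 2 + ∫ t, h (x₀ + inner ℝ (e t) w) ∂μ =
      (1 / c ^ 2) * (∫ t in Ioc s u, w t ^ 2) + ∫ t in Ioc s u, h (x₀ + ∫ r in s..t, w r) := by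
    intro w
    rw [hnorm]
    congr 1
    apply setIntegral_congr_fun measurableSet_Ioc
    intro t ht
    simp only [he t (Ioc_subset_Icc_self ht)]
  have hmeas : ∀ w : Lp ℝ 2 μ, AEStronglyMeasurable (fun t => h (x₀ + inner ℝ (e t) w)) μ := by
    intro w
    have hvi : IntervalIntegrable w volume s u :=
      (intervalIntegrable_iff_integrableOn_Icc_of_le hsu.le).mpr (hwI w).1
    have hcz : ContinuousOn (fun t => x₀ + ∫ r in s..t, w r) (uIcc s u) :=
      continuousOn_const.add
        (hvi.absolutelyContinuousOnInterval_intervalIntegral (c := s) left_mem_uIcc).continuousOn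
    rw [uIcc_of_le hsu.le] at hcz
    have h1 : ContinuousOn (fun t => h (x₀ + inner ℝ (e t) w)) (Icc s u) :=
      (hhc.comp_continuousOn hcz).congr fun t ht => by simp only [he t ht, Function.comp]
    exact (h1.mono Ioc_subset_Icc_self).aestronglyMeasurable measurableSet_Ioc
  -- every admissible pair comes from an element of the Hilbert space
  have hsurj : ∀ z v : ℝ → ℝ, AdmissiblePair s u x₀ x₁ z v → ∃ w : Lp ℝ 2 μ, w =ᵐ[μ] v := by
    rintro z v ⟨hv, hv2, -, -⟩
    rw [integrableOn_Icc_iff_integrableOn_Ioc enorm_ne_top] at hv hv2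
    have : MemLp v 2 μ := (memLp_two_iff_integrable_sq hv.aestronglyMeasurable).mpr hv2
    exact ⟨this.toLp v, this.coeFn_toLp⟩
  have hcongr : ∀ (w : Lp ℝ 2 μ) (v : ℝ → ℝ), w =ᵐ[μ] v → ∀ t ∈ Icc s u,
      ∫ r in s..t, w r = ∫ r in s..t, v r := by
    intro w v hwv t ht
    rw [intervalIntegral.integral_of_le ht.1, intervalIntegral.integral_of_le ht.1]
    apply integral_congr_ae
    exact ae_mono (Measure.restrict_mono_set _ (Ioc_subset_Ioc_right ht.2)) hwv
  have hne : ∃ w : Lp ℝ 2 μ, x₀ + inner ℝ (e u) w = x₁ := by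
    let k : ℝ := (x₁ - x₀) / (u - s)
    have hk : MemLp (fun _ : ℝ => k) 2 μ := memLp_const k
    refine ⟨hk.toLp _, ?_⟩
    rw [he u (right_mem_Icc.mpr hsu.le),
      hcongr _ _ hk.coeFn_toLp u (right_mem_Icc.mpr hsu.le)]
    have : u - s ≠ 0 := (sub_pos.mpr hsu).ne'
    simp only [intervalIntegral.integral_const, smul_eq_mul, k]
    field_simp
    ring
  haveI : Fact ((2 : ENNReal) ≠ ⊤) := ⟨by simp⟩
  obtain ⟨W, hW, hmin⟩ := om_abstract μ e ‖e u‖ heR (e u) x₀ x₁ (1 / c ^ 2) _ ha h hhc hm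
    hmeas hne
  refine ⟨_, W, hadm W hW, fun z v hzv => ?_⟩
  obtain ⟨w, hw⟩ := hsurj z v hzv
  have hx1 : x₀ + ∫ r in s..u, v r = x₁ := by
    rw [← hzv.2.2.2, hzv.2.2.1 u (right_mem_Icc.mpr hsu.le)]
  have hwS : x₀ + inner ℝ (e u) w = x₁ := by
    rw [he u (right_mem_Icc.mpr hsu.le), hcongr w v hw u (right_mem_Icc.mpr hsu.le), hx1]
  have h1 := hmin w hwS
  rw [hJ, hJ] at h1
  rw [om_rewrite s u c d x₀ x₁ hsu f hf _ _ (hadm W hW), om_rewrite s u c d x₀ x₁ hsu f hf z v hzv]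
  have h2 : ∫ t in Ioc s u, w t ^ 2 = ∫ t in Ioc s u, v t ^ 2 := by
    apply integral_congr_ae
    filter_upwards [hw] with t ht
    rw [ht]
  have h3 : ∫ t in Ioc s u, h (x₀ + ∫ r in s..t, w r) =
      ∫ t in Ioc s u, h (x₀ + ∫ r in s..t, v r) := by
    apply setIntegral_congr_fun measurableSet_Ioc
    intro t ht
    simp only [hcongr w v hw t (Ioc_subset_Icc_self ht)]
  rw [h2, h3] at h1
  exact sub_le_sub_right h1 _

/-- Existence of a minimizer of the Onsager–Machlup functional over the admissible set
`A = {z ∈ H¹([s,u]) : z s = x₀, z u = x₁}`, assuming `f ∈ C¹` is globally Lipschitz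
with `f′ ≥ M` and the small-jump mean satisfies `d² ≥ M c²`. The minimizer is the most
probable path of the jump-diffusion connecting `x₀` and `x₁`. -/
theorem OMfunctional_exists_minimizer (s u c d x₀ x₁ M L : ℝ)
    (hsu : s < u) (hc : c ≠ 0) (f : ℝ → ℝ) (hf : ContDiff ℝ 1 f)
    (hLip : ∀ x y : ℝ, |f x - f y| ≤ L * |x - y|)
    (hlb : ∀ x : ℝ, M ≤ deriv f x) (hd : M * c ^ 2 ≤ d ^ 2) :
    ∃ zs vs : ℝ → ℝ, AdmissiblePair s u x₀ x₁ zs vs ∧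
      ∀ z v : ℝ → ℝ, AdmissiblePair s u x₀ x₁ z v →
        OMfunctional s u c d f zs vs ≤ OMfunctional s u c d f z v := by
  exact om_exists s u c d x₀ x₁ M hsu hc f hf hlb
end

section
/- Let s < u, c ≠ 0, d ∈ ℝ, and let f : ℝ → ℝ be twice continuously differentiable. A twice continuously differentiable function z : [s,u] → ℝ satisfies the Euler–Lagrange equation d/dt [∂OM/∂p (ż(t), z(t))] = ∂OM/∂z (ż(t), z(t)) for all t ∈ [s,u] if and only if it satisfies the second-order ODE z̈(t) = (c²/2) f″(z(t)) + f′(z(t)) f(z(t)) − f′(z(t)) d for all t ∈ [s,u]. -/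
/-- A `C²` function `z` satisfies the Euler–Lagrange equation
`d/dt [∂OM/∂p (ż, z)] = ∂OM/∂z (ż, z)` on `[s,u]` if and only if it satisfies the
second-order ODE `z̈ = (c²/2) f″(z) + f′(z) f(z) − f′(z) d` on `[s,u]`. -/
theorem EL_iff_ODE (s u c d : ℝ) (hsu : s < u) (hc : c ≠ 0)
    (f z : ℝ → ℝ) (hf : ContDiff ℝ 2 f) (hz : ContDiff ℝ 2 z) :
    (∀ t ∈ Set.Icc s u,
      HasDerivAt (fun τ => deriv (fun p => OMfn f c d p (z τ)) (deriv z τ))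
        (deriv (fun y => OMfn f c d (deriv z t) y) (z t)) t) ↔
    (∀ t ∈ Set.Icc s u,
      deriv (deriv z) t =
        c ^ 2 / 2 * deriv (deriv f) (z t) + deriv f (z t) * f (z t)
          - deriv f (z t) * d) := by
  have hf1 : Differentiable ℝ f := hf.differentiable (by norm_num)
  have hz1 : Differentiable ℝ z := hz.differentiable (by norm_num)
  have hf2 : Differentiable ℝ (deriv f) :=
    ((contDiff_succ_iff_deriv (n := 1)).1 hf).2.2.differentiable (by norm_num)
  have hz2 : Differentiable ℝ (deriv z) :=
    ((contDiff_succ_iff_deriv (n := 1)).1 hz).2.2.differentiable (by norm_num)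
  -- the momentum `∂OM/∂p`
  have hp : ∀ p y : ℝ, deriv (fun p => OMfn f c d p y) p
      = 2 * (p - f y) / c ^ 2 + 2 * d / c ^ 2 := by
    intro p y
    have h0 : HasDerivAt (fun p : ℝ => p - f y) 1 p := (hasDerivAt_id p).sub_const (f y)
    have h := (((h0.div_const c).pow 2).add_const (deriv f y)).add
      (((h0.div_const (c ^ 2)).const_mul 2).mul_const d)
    refine (HasDerivAt.deriv (h.congr_deriv ?_ : HasDerivAt (fun p => OMfn f c d p y) _ p))
    simp only [Nat.add_one_sub_one, pow_one, Nat.cast_ofNat, Nat.reduceSub]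
    field_simp
    try ring
  -- the force `∂OM/∂z`
  have hy : ∀ p y : ℝ, deriv (fun y => OMfn f c d p y) y
      = -2 * (p - f y) * deriv f y / c ^ 2 + deriv (deriv f) y - 2 * deriv f y * d / c ^ 2 := by
    intro p y
    have h0 : HasDerivAt (fun y : ℝ => p - f y) (-deriv f y) y :=
      (hf1 y).hasDerivAt.const_sub p
    have h := (((h0.div_const c).pow 2).add (hf2 y).hasDerivAt).add
      (((h0.div_const (c ^ 2)).const_mul 2).mul_const d)
    refine (HasDerivAt.deriv (h.congr_deriv ?_ : HasDerivAt (fun y => OMfn f c d p y) _ y))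
    simp only [Nat.add_one_sub_one, pow_one, Nat.cast_ofNat, Nat.reduceSub]
    field_simp
    try ring
  simp only [hp, hy]
  refine forall₂_congr fun t _ => ?_
  have hL : HasDerivAt (fun τ => 2 * (deriv z τ - f (z τ)) / c ^ 2 + 2 * d / c ^ 2)
      (2 * (deriv (deriv z) t - deriv f (z t) * deriv z t) / c ^ 2) t :=
    ((((hz2 t).hasDerivAt.sub
      ((hf1 (z t)).hasDerivAt.comp t (hz1 t).hasDerivAt)).const_mul 2).div_const
        (c ^ 2)).add_const _
  have key : (2 * (deriv (deriv z) t - deriv f (z t) * deriv z t) / c ^ 2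
      = -2 * (deriv z t - f (z t)) * deriv f (z t) / c ^ 2 + deriv (deriv f) (z t)
        - 2 * deriv f (z t) * d / c ^ 2) ↔
      deriv (deriv z) t =
        c ^ 2 / 2 * deriv (deriv f) (z t) + deriv f (z t) * f (z t)
          - deriv f (z t) * d := by
    field_simp
    constructor <;> intro h <;> linarith
  rw [← key]
  exact ⟨fun h => hL.unique h, fun h => h ▸ hL⟩
end

section
/- Let s < u, c ≠ 0, d ∈ ℝ, and let f : ℝ → ℝ be twice continuously differentiable. Let z : [s,u] → ℝ be twice continuously differentiable with z(s) = x₀ and z(u) = x₁. If for every twice continuously differentiable η : [s,u] → ℝ with η(s) = η(u) = 0 the function ε ↦ I[z + ε η] has derivative zero at ε = 0 (vanishing first variation), then z satisfies z̈(t) = (c²/2) f″(z(t)) + f′(z(t)) f(z(t)) − f′(z(t)) d for all t ∈ [s,u]. -/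
/-- The `ε`-derivative of the perturbed integrand. -/
noncomputable def OMvar (f z η : ℝ → ℝ) (c d ε t : ℝ) : ℝ :=
  2 * ((deriv z t + ε * deriv η t - f (z t + ε * η t)) / c)
      * ((deriv η t - deriv f (z t + ε * η t) * η t) / c)
    + deriv (deriv f) (z t + ε * η t) * η t
    + 2 * ((deriv η t - deriv f (z t + ε * η t) * η t) / c ^ 2) * d

lemma contDeriv {f : ℝ → ℝ} (hf : ContDiff ℝ 2 f) :
    ContDiff ℝ 1 (deriv f) := by
  have h : ContDiff ℝ (1 + 1) f := by
    have e : (1 + 1 : WithTop ℕ∞) = 2 := by norm_num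
    rw [e]; exact hf
  exact (contDiff_succ_iff_deriv.1 h).2.2

lemma firstVar (s u c d : ℝ)
    (f z η : ℝ → ℝ) (hf : ContDiff ℝ 2 f) (hz : ContDiff ℝ 2 z) (hη : ContDiff ℝ 2 η) :
    HasDerivAt (fun ε : ℝ =>
        ∫ t in s..u,
          OMfn f c d (deriv (fun τ => z τ + ε * η τ) t) (z t + ε * η t))
      (∫ t in s..u, OMvar f z η c d 0 t) 0 := by
  have df := hf.differentiable (by norm_num)
  have dz := hz.differentiable (by norm_num)
  have dη := hη.differentiable (by norm_num)
  have df' := (contDeriv hf).differentiable (by norm_num)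
  have cf := hf.continuous
  have cz := hz.continuous
  have cη := hη.continuous
  have cf' := (contDeriv hf).continuous
  have cz' := (contDeriv hz).continuous
  have cη' := (contDeriv hη).continuous
  have cf'' : Continuous (deriv (deriv f)) := (contDeriv hf).continuous_deriv (by norm_num)
  have hder : ∀ ε t : ℝ, deriv (fun τ => z τ + ε * η τ) t = deriv z t + ε * deriv η t := by
    intro ε t
    exact ((dz t).hasDerivAt.add ((dη t).hasDerivAt.const_mul ε)).deriv
  simp only [hder]
  have hcont : Continuous (fun q : ℝ × ℝ => OMvar f z η c d q.1 q.2) := by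
    unfold OMvar
    simp only [div_eq_mul_inv]
    fun_prop
  have hcontF : ∀ ε : ℝ, Continuous
      (fun t => OMfn f c d (deriv z t + ε * deriv η t) (z t + ε * η t)) := by
    intro ε
    unfold OMfn
    simp only [div_eq_mul_inv]
    fun_prop
  obtain ⟨C, hC⟩ := ((isCompact_Icc (a := (-1 : ℝ)) (b := 1)).prod
    (isCompact_uIcc (a := s) (b := u))).exists_bound_of_continuousOn hcont.continuousOn
  refine (intervalIntegral.hasDerivAt_integral_of_dominated_loc_of_deriv_le
    (F' := fun ε t => OMvar f z η c d ε t) (bound := fun _ => C)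
    (s := Set.Icc (-1) 1) (Icc_mem_nhds (by norm_num) (by norm_num))
    (Filter.Eventually.of_forall fun ε => (hcontF ε).aestronglyMeasurable)
    ((hcontF 0).intervalIntegrable _ _) ?_ ?_ (by simp) ?_).2
  · exact (hcont.comp (by fun_prop : Continuous fun t : ℝ => ((0 : ℝ), t))).aestronglyMeasurable
  · exact Filter.Eventually.of_forall fun t ht ε hε =>
      hC (ε, t) ⟨hε, Set.uIoc_subset_uIcc ht⟩
  · refine Filter.Eventually.of_forall fun t _ ε _ => ?_
    have hy : HasDerivAt (fun ε : ℝ => z t + ε * η t) (η t) ε := by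
      simpa using ((hasDerivAt_id ε).mul_const (η t)).const_add (z t)
    have hp : HasDerivAt (fun ε : ℝ => deriv z t + ε * deriv η t) (deriv η t) ε := by
      simpa using ((hasDerivAt_id ε).mul_const (deriv η t)).const_add (deriv z t)
    have h1 := (df (z t + ε * η t)).hasDerivAt.comp ε hy
    have h2 := (df' (z t + ε * η t)).hasDerivAt.comp ε hy
    have h3 := hp.sub h1
    have h4 := (((h3.div_const c).pow 2).add h2).add
      (((h3.div_const (c ^ 2)).const_mul 2).mul_const d)
    refine h4.congr_deriv ?_
    simp [OMvar]

/-- If a `C²` path `z` with `z s = x₀`, `z u = x₁` has vanishing first variation of the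
OM functional (i.e. for every `C²` perturbation `η` vanishing at the endpoints, the map
`ε ↦ I[z + ε η]` has derivative zero at `ε = 0`), then `z` satisfies the Euler–Lagrange
ODE `z̈ = (c²/2) f″(z) + f′(z) f(z) − f′(z) d` on `[s,u]`. -/
theorem firstVariation_zero_implies_ODE (s u c d x₀ x₁ : ℝ) (hsu : s < u) (hc : c ≠ 0)
    (f z : ℝ → ℝ) (hf : ContDiff ℝ 2 f) (hz : ContDiff ℝ 2 z)
    (hzs : z s = x₀) (hzu : z u = x₁)
    (hvar : ∀ η : ℝ → ℝ, ContDiff ℝ 2 η → η s = 0 → η u = 0 →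
      HasDerivAt (fun ε : ℝ =>
        ∫ t in s..u,
          OMfn f c d (deriv (fun τ => z τ + ε * η τ) t) (z t + ε * η t)) 0 0) :
    ∀ t ∈ Set.Icc s u,
      deriv (deriv z) t =
        c ^ 2 / 2 * deriv (deriv f) (z t) + deriv f (z t) * f (z t)
          - deriv f (z t) * d := by
  have dz := hz.differentiable (by norm_num)
  have df := hf.differentiable (by norm_num)
  have cf := hf.continuous
  have cz := hz.continuous
  have cf' := (contDeriv hf).continuous
  have cz' := (contDeriv hz).continuous
  have dz' := (contDeriv hz).differentiable (by norm_num)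
  have cf'' : Continuous (deriv (deriv f)) := (contDeriv hf).continuous_deriv (by norm_num)
  have cz'' : Continuous (deriv (deriv z)) := (contDeriv hz).continuous_deriv (by norm_num)
  set g : ℝ → ℝ := fun t => deriv (deriv z) t -
    (c ^ 2 / 2 * deriv (deriv f) (z t) + deriv f (z t) * f (z t) - deriv f (z t) * d) with hg
  have cg : Continuous g := by fun_prop
  have key : ∀ η : ℝ → ℝ, ContDiff ℝ 2 η → η s = 0 → η u = 0 →
      ∫ t in s..u, η t * g t = 0 := by
    intro η hη hs hu
    have cη := hη.continuous
    have cη' := (contDeriv hη).continuous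
    have dη := hη.differentiable (by norm_num)
    have h0 := (firstVar s u c d f z η hf hz hη).unique (hvar η hη hs hu)
    have hA : ∀ t, HasDerivAt (fun t => (deriv z t - f (z t) + d) * η t)
        ((deriv (deriv z) t - deriv f (z t) * deriv z t) * η t
          + (deriv z t - f (z t) + d) * deriv η t) t := by
      intro t
      exact (((dz' t).hasDerivAt.sub
        ((df (z t)).hasDerivAt.comp t (dz t).hasDerivAt)).add_const d).mul (dη t).hasDerivAt
    have h1 := intervalIntegral.integral_eq_sub_of_hasDerivAt (a := s) (b := u)
      (fun t _ => hA t) (Continuous.intervalIntegrable (by fun_prop) _ _)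
    simp only [hs, hu, mul_zero, sub_zero] at h1
    have hV : Continuous (fun t => OMvar f z η c d 0 t) := by
      unfold OMvar
      simp only [div_eq_mul_inv]
      fun_prop
    have e : ∀ t, η t * g t = ((deriv (deriv z) t - deriv f (z t) * deriv z t) * η t
          + (deriv z t - f (z t) + d) * deriv η t) - c ^ 2 / 2 * OMvar f z η c d 0 t := by
      intro t
      simp only [hg, OMvar, zero_mul, add_zero]
      field_simp
      ring
    simp only [e]
    rw [intervalIntegral.integral_sub (Continuous.intervalIntegrable (by fun_prop) _ _)
      (Continuous.intervalIntegrable (by fun_prop) _ _), h1,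
      intervalIntegral.integral_const_mul, h0]
    simp
  have hae : ∀ᵐ x, x ∈ Set.Ioo s u → g x = 0 := by
    refine isOpen_Ioo.ae_eq_zero_of_integral_contDiff_smul_eq_zero
      (cg.locallyIntegrable.locallyIntegrableOn _) ?_
    intro η hη _ hsupp
    have hz0 : ∀ x, x ∉ Set.Ioo s u → η x = 0 := fun x hx =>
      image_eq_zero_of_notMem_tsupport fun h => hx (hsupp h)
    have := key η (by exact_mod_cast contDiff_infty.1 hη 2) (hz0 s (by simp)) (hz0 u (by simp))
    rw [intervalIntegral.integral_of_le hsu.le,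
      MeasureTheory.setIntegral_eq_integral_of_forall_compl_eq_zero] at this
    · simpa using this
    · intro x hx
      rw [hz0 x fun h => hx (Set.Ioo_subset_Ioc_self h), zero_mul]
  have hIcc : Set.EqOn g (fun _ => 0) (Set.Icc s u) := by
    refine MeasureTheory.Measure.eqOn_Icc_of_ae_eq MeasureTheory.volume hsu.ne ?_
      cg.continuousOn continuousOn_const
    rw [MeasureTheory.Measure.restrict_congr_set MeasureTheory.Ioo_ae_eq_Icc.symm]
    exact (MeasureTheory.ae_restrict_iff' measurableSet_Ioo).2 hae
  intro t ht
  exact sub_eq_zero.1 (hIcc ht)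
end

section
/- Let T > 0 and d, x₀, x₁ ∈ ℝ, and consider the Lagrangian L(p, z) = (z + p)² − 1 + 2(p + z) d (the Onsager–Machlup function of the linear system with drift f(z) = −z and c = 1). If z_m : [0,T] → ℝ is twice continuously differentiable, satisfies z̈_m(t) = z_m(t) + d on [0,T] and z_m(0) = x₀, z_m(T) = x₁, then for every continuously differentiable z : [0,T] → ℝ with z(0) = x₀ and z(T) = x₁ one has ∫₀ᵀ L(ż_m(t), z_m(t)) dt ≤ ∫₀ᵀ L(ż(t), z(t)) dt; that is, z_m is a global minimizer of the OM functional. -/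
/-- For the Onsager–Machlup Lagrangian `L(p, z) = (z + p)² − 1 + 2(p + z) d` of the
linear system with drift `f(z) = −z` and `c = 1`: any `C²` solution `z_m` of
`z̈_m = z_m + d` on `[0,T]` with `z_m 0 = x₀`, `z_m T = x₁` is a global minimizer of
the OM functional among `C¹` paths with the same boundary values. -/
theorem linear_OM_global_minimizer (T d x₀ x₁ : ℝ) (hT : 0 < T) (zm : ℝ → ℝ)
    (hzm : ContDiff ℝ 2 zm)
    (hode : ∀ t ∈ Set.Icc (0 : ℝ) T, deriv (deriv zm) t = zm t + d)
    (h0 : zm 0 = x₀) (h1 : zm T = x₁) :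
    ∀ z : ℝ → ℝ, ContDiff ℝ 1 z → z 0 = x₀ → z T = x₁ →
      (∫ t in (0 : ℝ)..T,
          ((zm t + deriv zm t) ^ 2 - 1 + 2 * (deriv zm t + zm t) * d)) ≤
        ∫ t in (0 : ℝ)..T,
          ((z t + deriv z t) ^ 2 - 1 + 2 * (deriv z t + z t) * d) := by
  intro z hz hz0 hz1
  have hzmd : Differentiable ℝ zm := hzm.differentiable (by norm_num)
  have hzd : Differentiable ℝ z := hz.differentiable (by norm_num)
  have hzm' : ContDiff ℝ 1 (deriv zm) := by
    have h2 : ContDiff ℝ (1 + 1) zm := by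
      have e : (1 + 1 : WithTop ℕ∞) = 2 := by norm_num
      rw [e]; exact hzm
    exact (contDiff_succ_iff_deriv.1 h2).2.2
  have hzmdd : Differentiable ℝ (deriv zm) := hzm'.differentiable (by norm_num)
  have c1 : Continuous zm := hzmd.continuous
  have c2 : Continuous (deriv zm) := hzmdd.continuous
  have c3 : Continuous z := hzd.continuous
  have c4 : Continuous (deriv z) := hz.continuous_deriv (by norm_num)
  -- the first variation is a total derivative vanishing at both ends
  have key : ∫ t in (0 : ℝ)..T, 2 * ((z t - zm t) + (deriv z t - deriv zm t)) *
      (zm t + deriv zm t + d) = 0 := by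
    rw [intervalIntegral.integral_eq_sub_of_hasDerivAt
      (f := fun t => 2 * (z t - zm t) * (zm t + deriv zm t + d))]
    · simp [hz0, hz1, h0, h1]
    · intro t ht
      rw [Set.uIcc_of_le hT.le] at ht
      have a := (((hzd t).hasDerivAt.sub (hzmd t).hasDerivAt).const_mul 2).mul
        (((hzmd t).hasDerivAt.add (hzmdd t).hasDerivAt).add_const d)
      refine a.congr_deriv ?_
      simp only [Pi.sub_apply, Pi.add_apply]
      rw [hode t ht]
      ring
    · exact Continuous.intervalIntegrable (by fun_prop) _ _
  refine (add_zero _).symm.le.trans ((add_le_add_right key.symm.le _).trans ?_)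
  rw [
    ← intervalIntegral.integral_add (Continuous.intervalIntegrable (by fun_prop) _ _)
      (Continuous.intervalIntegrable (by fun_prop) _ _)]
  refine intervalIntegral.integral_mono_on hT.le
    (Continuous.intervalIntegrable (by fun_prop) _ _)
    (Continuous.intervalIntegrable (by fun_prop) _ _) ?_
  intro t _
  nlinarith [sq_nonneg ((z t - zm t) + (deriv z t - deriv zm t))]
end
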